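/- Let R be the 3×3 rook's graph, i.e., the Cartesian product K_3 □ K_3 of two triangles (equivalently, the line graph of K_{3,3}). Then the chromatic number of R is 3 and the distinguishing chromatic number of R is 5. -/

import Mathlib

open SimpleGraph

/-- A proper colouring `c` of `G` is distinguishing if the identity is the only
automorphism of `G` preserving `c`. -/
def SimpleGraph.IsDistinguishingColoring {V α : Type*} (G : SimpleGraph V)
    (c : G.Coloring α) : Prop :=
  ∀ φ : G ≃g G, (∀ v, c (φ v) = c v) → ∀ v, φ v = v

/-- The distinguishing chromatic number of `G`: the least `k` such that `G` has a
proper vertex colouring with `k` colours preserved only by the identity automorphism. -/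
noncomputable def SimpleGraph.distChromNum {V : Type*} (G : SimpleGraph V) : ℕ :=
  sInf {k | ∃ c : G.Coloring (Fin k), G.IsDistinguishingColoring c}

/-- The maximum degree of `G`, stated without decidability assumptions. -/
noncomputable def SimpleGraph.maxDeg {V : Type*} [Fintype V] (G : SimpleGraph V) : ℕ := by
  classical exact G.maxDegree

/-- `G` contains no induced subgraph isomorphic to `H`. -/
def SimpleGraph.IsFreeOf {V W : Type*} (G : SimpleGraph V) (H : SimpleGraph W) : Prop :=
  ¬ Nonempty (H ↪g G)


/-- The 3×3 rook's graph. -/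
abbrev rookG : SimpleGraph (Fin 3 × Fin 3) :=
  (⊤ : SimpleGraph (Fin 3)) □ (⊤ : SimpleGraph (Fin 3))

/-- An involution of the vertex set preserving adjacency, as an automorphism. -/
def rookIso (p : Fin 3 × Fin 3 → Fin 3 × Fin 3) (hp : ∀ v, p (p v) = v)
    (ha : ∀ u v, rookG.Adj u v → rookG.Adj (p u) (p v)) : rookG ≃g rookG where
  toEquiv := ⟨p, p, hp, hp⟩
  map_rel_iff' := by
    intro u v
    refine ⟨fun h => ?_, fun h => ha u v h⟩
    have := ha _ _ h
    simpa [hp] using this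

/-- Transposition of `Fin 3` fixing `i`. -/
def refl3 (i x : Fin 3) : Fin 3 := -x - i

/-- Involutions acting on rows and columns. -/
def invA (i j : Fin 3) (v : Fin 3 × Fin 3) : Fin 3 × Fin 3 := (refl3 i v.1, refl3 j v.2)

/-- Transpose-type involutions (rotation kind). -/
def invB (i : Fin 3) (v : Fin 3 × Fin 3) : Fin 3 × Fin 3 := (v.2 + i, v.1 - i)

/-- Transpose-type involutions (reflection kind). -/
def invC (i : Fin 3) (v : Fin 3 × Fin 3) : Fin 3 × Fin 3 := (refl3 i v.2, refl3 i v.1)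

instance : DecidableRel rookG.Adj := fun u v =>
  decidable_of_iff (u.1 ≠ v.1 ∧ u.2 = v.2 ∨ u.2 ≠ v.2 ∧ u.1 = v.1) (by
    simp [rookG, SimpleGraph.boxProd_adj])

lemma not_dist {α : Type*} (c : rookG.Coloring α) (hc : rookG.IsDistinguishingColoring c)
    (p : Fin 3 × Fin 3 → Fin 3 × Fin 3) (hp : ∀ v, p (p v) = v)
    (ha : ∀ u v, rookG.Adj u v → rookG.Adj (p u) (p v)) (hn : ∃ v, p v ≠ v)
    (h : ∀ v, c (p v) = c v) : False := by
  obtain ⟨v, hv⟩ := hn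
  exact hv (hc (rookIso p hp ha) h v)

/-- The colouring with given rows. -/
def mkCol (a b c d e f g h i : Fin 4) (v : Fin 3 × Fin 3) : Fin 4 :=
  match v with
  | (0, 0) => a | (0, 1) => b | (0, 2) => c
  | (1, 0) => d | (1, 1) => e | (1, 2) => f
  | (2, 0) => g | (2, 1) => h | (2, 2) => i

set_option synthInstance.maxHeartbeats 400000 in
set_option synthInstance.maxSize 2000 in
set_option maxSynthPendingDepth 10 in
lemma key : ∀ a b : Fin 4, a ≠ b → ∀ c, a ≠ c → b ≠ c → ∀ d, a ≠ d → ∀ e, b ≠ e → d ≠ e →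
    ∀ f, c ≠ f → d ≠ f → e ≠ f → ∀ g, a ≠ g → d ≠ g → ∀ h, b ≠ h → e ≠ h → g ≠ h →
    ∀ i, c ≠ i → f ≠ i → g ≠ i → h ≠ i →
    (∃ x, ∀ v, mkCol a b c d e f g h i (invB x v) = mkCol a b c d e f g h i v) ∨
    (∃ x, ∀ v, mkCol a b c d e f g h i (invC x v) = mkCol a b c d e f g h i v) ∨
    (∃ x y, ∀ v, mkCol a b c d e f g h i (invA x y v) = mkCol a b c d e f g h i v) := by
  decide +kernel

lemma not_four (c : rookG.Coloring (Fin 4)) : ¬ rookG.IsDistinguishingColoring c := by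
  intro hc
  have hv : ∀ u v, rookG.Adj u v → c u ≠ c v := fun u v h => c.valid h
  have e : ∀ v, mkCol (c (0,0)) (c (0,1)) (c (0,2)) (c (1,0)) (c (1,1)) (c (1,2))
      (c (2,0)) (c (2,1)) (c (2,2)) v = c v := by
    rintro ⟨x, y⟩
    fin_cases x <;> fin_cases y <;> rfl
  have := key (c (0,0)) (c (0,1)) (hv _ _ (by decide)) (c (0,2)) (hv _ _ (by decide))
    (hv _ _ (by decide)) (c (1,0)) (hv _ _ (by decide)) (c (1,1)) (hv _ _ (by decide))
    (hv _ _ (by decide)) (c (1,2)) (hv _ _ (by decide)) (hv _ _ (by decide))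
    (hv _ _ (by decide)) (c (2,0)) (hv _ _ (by decide)) (hv _ _ (by decide))
    (c (2,1)) (hv _ _ (by decide)) (hv _ _ (by decide)) (hv _ _ (by decide))
    (c (2,2)) (hv _ _ (by decide)) (hv _ _ (by decide)) (hv _ _ (by decide))
    (hv _ _ (by decide))
  simp only [e] at this
  rcases this with ⟨x, h⟩ | ⟨x, h⟩ | ⟨x, y, h⟩
  · exact not_dist c hc (invB x) (by clear h; revert x; decide +kernel) (by clear h; revert x; decide +kernel)
      (by clear h; revert x; decide +kernel) h
  · exact not_dist c hc (invC x) (by clear h; revert x; decide +kernel) (by clear h; revert x; decide +kernel)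
      (by clear h; revert x; decide +kernel) h
  · exact not_dist c hc (invA x y) (by clear h; revert x y; decide +kernel)
      (by clear h; revert x y; decide +kernel) (by clear h; revert x y; decide +kernel) h

/-- A distinguishing 5-colouring. -/
def col5 (v : Fin 3 × Fin 3) : Fin 5 :=
  match v with
  | (0, 0) => 0 | (0, 1) => 2 | (0, 2) => 3
  | (1, 0) => 4 | (1, 1) => 1 | (1, 2) => 2
  | (2, 0) => 2 | (2, 1) => 3 | (2, 2) => 4

lemma five : ∃ c : rookG.Coloring (Fin 5), rookG.IsDistinguishingColoring c := by
  refine ⟨SimpleGraph.Coloring.mk col5 (fun {u v} => by revert u v; decide +kernel), ?_⟩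
  intro φ h v
  replace h : ∀ v, col5 (φ v) = col5 v := h
  have h0 : φ (0,0) = (0,0) :=
    (by decide +kernel : ∀ w, col5 w = col5 (0,0) → w = (0,0)) _ (h _)
  have h1 : φ (1,1) = (1,1) :=
    (by decide +kernel : ∀ w, col5 w = col5 (1,1) → w = (1,1)) _ (h _)
  have a0 : rookG.Adj (0,0) (φ v) ↔ rookG.Adj (0,0) v := by
    have := φ.map_adj_iff (v := (0,0)) (w := v)
    rwa [h0] at this
  have a1 : rookG.Adj (1,1) (φ v) ↔ rookG.Adj (1,1) v := by
    have := φ.map_adj_iff (v := (1,1)) (w := v)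
    rwa [h1] at this
  exact (by decide +kernel : ∀ w v, col5 w = col5 v → (rookG.Adj (0,0) w ↔ rookG.Adj (0,0) v) →
    (rookG.Adj (1,1) w ↔ rookG.Adj (1,1) v) → w = v) _ _ (h v) a0 a1

lemma chrom : rookG.chromaticNumber = 3 := by
  apply le_antisymm
  · have : rookG.Colorable 3 :=
      ⟨SimpleGraph.Coloring.mk (fun v => v.1 + v.2) (fun {u v} => by revert u v; decide +kernel)⟩
    exact_mod_cast this.chromaticNumber_le
  · have : rookG.IsClique (({(0,0), (0,1), (0,2)} : Finset (Fin 3 × Fin 3)) : Set _) := by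
      intro u hu v hv
      have hu' := Finset.mem_coe.1 hu
      have hv' := Finset.mem_coe.1 hv
      clear hu hv
      revert u v
      decide +kernel
    exact_mod_cast this.card_le_chromaticNumber

theorem statement_12 :
    ((⊤ : SimpleGraph (Fin 3)) □ (⊤ : SimpleGraph (Fin 3))).chromaticNumber = 3 ∧
    ((⊤ : SimpleGraph (Fin 3)) □ (⊤ : SimpleGraph (Fin 3))).distChromNum = 5 := by
  refine ⟨chrom, ?_⟩
  apply le_antisymm
  · exact Nat.sInf_le five
  · refine le_csInf ⟨5, five⟩ ?_
    rintro k ⟨c, hc⟩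
    by_contra hk
    have hk4 : k ≤ 4 := by omega
    refine not_four (SimpleGraph.Coloring.mk (fun v => Fin.castLE hk4 (c v)) ?_) ?_
    · intro u v h he
      exact c.valid h (Fin.castLE_injective hk4 he)
    · intro φ h
      exact hc φ (fun v => Fin.castLE_injective hk4 (h v))
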